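/- For all positive integers m, f_3(2m, 4, 3) ≤ f_3(m, 4, 3) + 2⌈log m⌉ · g(m). -/

import Mathlib

/-- An edge coloring of the grid graph `Γ_{m,n}` (on vertex set `Fin m × Fin n`),
given as a function on unordered pairs of vertices, has an *alternating rectangle*
if there are `i < i'` and `j < j'` such that the two column edges
`{(i,j),(i',j)}`, `{(i,j'),(i',j')}` get the same color and the two row edges
`{(i,j),(i,j')}`, `{(i',j),(i',j')}` get the same color. -/
def HasAltRect {m n : ℕ} {α : Type*} (c : Sym2 (Fin m × Fin n) → α) : Prop :=
  ∃ i i' : Fin m, ∃ j j' : Fin n, i < i' ∧ j < j' ∧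
    c s((i, j), (i', j)) = c s((i, j'), (i', j')) ∧
    c s((i, j), (i, j')) = c s((i', j), (i', j'))

/-- Two vertices of the grid graph `Γ_{m,n}` are adjacent iff they are distinct
and agree in one of the coordinates. -/
def gridAdj {m n : ℕ} (x y : Fin m × Fin n) : Prop :=
  x ≠ y ∧ (x.1 = y.1 ∨ x.2 = y.2)

/-- `g m n` is the minimum number of colors in an alternating-rectangle-free
edge coloring of the grid graph `Γ_{m,n}`. -/
noncomputable def gGrid (m n : ℕ) : ℕ :=
  sInf {r : ℕ | ∃ c : Sym2 (Fin m × Fin n) → ℕ,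
    (∀ x y : Fin m × Fin n, gridAdj x y → c s(x, y) < r) ∧ ¬ HasAltRect c}

/-- `f3 n p q` is the minimum number `r` of colors in a coloring of the 3-element
subsets of an `n`-element set such that every `p` vertices span at least `q`
distinct colors on their 3-subsets. -/
noncomputable def f3 (n p q : ℕ) : ℕ :=
  sInf {r : ℕ | ∃ c : Finset (Fin n) → ℕ,
    (∀ s : Finset (Fin n), s.card = 3 → c s < r) ∧
    ∀ P : Finset (Fin n), P.card = p → q ≤ ((P.powersetCard 3).image c).card}


open Finset

/-- Three triples of `P` with pairwise distinct colors witness that `P` spans three colors. -/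
theorem three_le_card_image_powersetCard {V α : Type*} [DecidableEq α] {c : Finset V → α}
    {P s t u : Finset V} (hs : s ⊆ P ∧ s.card = 3) (ht : t ⊆ P ∧ t.card = 3)
    (hu : u ⊆ P ∧ u.card = 3) (hst : c s ≠ c t) (hsu : c s ≠ c u) (htu : c t ≠ c u) :
    3 ≤ ((P.powersetCard 3).image c).card :=
  two_lt_card.2 ⟨c s, mem_image_of_mem c (mem_powersetCard.2 hs),
    c t, mem_image_of_mem c (mem_powersetCard.2 ht),
    c u, mem_image_of_mem c (mem_powersetCard.2 hu), hst, hsu, htu⟩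

/-- Any finite vertex set and any finite set of colors may be used to bound `f3`. -/
theorem f3_le_card {V α : Type*} [Fintype V] [DecidableEq α] {n p q : ℕ}
    (hV : Fintype.card V = n) (c : Finset V → α) (T : Finset α)
    (hT : ∀ s : Finset V, s.card = 3 → c s ∈ T)
    (hc : ∀ P : Finset V, P.card = p → q ≤ ((P.powersetCard 3).image c).card) :
    f3 n p q ≤ T.card := by
  classical
  let e : Fin n ≃ V := (Fintype.equivFinOfCardEq hV).symm
  let φ : α → ℕ := fun a => if h : a ∈ T then T.equivFin ⟨a, h⟩ else 0
  have hφ : ∀ a ∈ T, ∀ b ∈ T, φ a = φ b → a = b := by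
    intro a ha b hb h
    simpa [φ, ha, hb, Fin.val_inj] using h
  refine Nat.sInf_le ⟨fun s => φ (c (s.map e.toEmbedding)), fun s hs => ?_, fun P hP => ?_⟩
  · have := hT (s.map e.toEmbedding) (by simpa using hs)
    simp only [φ, this, dif_pos]
    exact Fin.is_lt _
  · have himage : (P.powersetCard 3).image (fun s => φ (c (s.map e.toEmbedding))) =
        (((P.map e.toEmbedding).powersetCard 3).image c).image φ := by
      rw [powersetCard_map, map_eq_image, image_image, image_image]
      rfl
    rw [himage, card_image_of_injOn]
    · exact hc _ (by simpa using hP)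
    · intro a ha b hb h
      obtain ⟨s, hs, rfl⟩ := mem_image.1 ha
      obtain ⟨t, ht, rfl⟩ := mem_image.1 hb
      exact hφ _ (hT _ (mem_powersetCard.1 hs).2) _ (hT _ (mem_powersetCard.1 ht).2) h

/-- The minimum defining `f3 n 4 3` is attained. -/
theorem exists_coloring_f3 (n : ℕ) : ∃ c : Finset (Fin n) → ℕ,
    (∀ s : Finset (Fin n), s.card = 3 → c s < f3 n 4 3) ∧
    ∀ P : Finset (Fin n), P.card = 4 → 3 ≤ ((P.powersetCard 3).image c).card := by
  have hne : {r : ℕ | ∃ c : Finset (Fin n) → ℕ,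
      (∀ s : Finset (Fin n), s.card = 3 → c s < r) ∧
      ∀ P : Finset (Fin n), P.card = 4 → 3 ≤ ((P.powersetCard 3).image c).card}.Nonempty := by
    refine ⟨_, fun s => Fintype.equivFin (Finset (Fin n)) s, fun s _ => Fin.is_lt _,
      fun P hP => ?_⟩
    have hinj : Function.Injective fun s => (Fintype.equivFin (Finset (Fin n)) s : ℕ) :=
      Fin.val_injective.comp (Equiv.injective _)
    rw [card_image_of_injective _ hinj, card_powersetCard, hP]
    decide
  exact Nat.sInf_mem hne

/-- The minimum defining `gGrid m n` is attained. -/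
theorem exists_coloring_gGrid (m n : ℕ) : ∃ c : Sym2 (Fin m × Fin n) → ℕ,
    (∀ x y : Fin m × Fin n, gridAdj x y → c s(x, y) < gGrid m n) ∧ ¬ HasAltRect c := by
  have hne : {r : ℕ | ∃ c : Sym2 (Fin m × Fin n) → ℕ,
      (∀ x y : Fin m × Fin n, gridAdj x y → c s(x, y) < r) ∧ ¬ HasAltRect c}.Nonempty := by
    refine ⟨_, fun s => Fintype.equivFin (Sym2 (Fin m × Fin n)) s, fun _ _ _ => Fin.is_lt _, ?_⟩
    rintro ⟨i, i', j, j', -, hj, h, -⟩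
    rw [Fin.val_inj, Equiv.apply_eq_iff_eq, Sym2.eq_iff] at h
    simp only [Prod.mk.injEq] at h
    omega
  exact Nat.sInf_mem hne

/-- The complete graph on `m` vertices has a triangle-proper edge coloring with `⌈log m⌉` colors. -/
theorem exists_coloring_pairs (m : ℕ) : ∃ d : Finset (Fin m) → ℕ,
    (∀ a b, a ≠ b → d {a, b} < Nat.clog 2 m) ∧
    ∀ a b c, a ≠ b → a ≠ c → b ≠ c → ¬ (d {a, b} = d {a, c} ∧ d {a, b} = d {b, c}) := by
  let S : Finset (Fin m) → Set ℕ := fun s =>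
    {k | ∃ a ∈ s, ∃ b ∈ s, (a : ℕ).testBit k ≠ (b : ℕ).testBit k}
  have hmem : ∀ a b : Fin m, a ≠ b →
      (a : ℕ).testBit (sInf (S {a, b})) ≠ (b : ℕ).testBit (sInf (S {a, b})) := by
    intro a b hab
    have hne : (S {a, b}).Nonempty := by
      obtain ⟨k, hk⟩ := Nat.exists_testBit_ne_of_ne (Fin.val_ne_of_ne hab)
      exact ⟨k, a, by simp, b, by simp, hk⟩
    obtain ⟨x, hx, y, hy, h⟩ := Nat.sInf_mem hne
    simp only [mem_insert, mem_singleton] at hx hy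
    rcases hx with rfl | rfl <;> rcases hy with rfl | rfl
    · exact absurd rfl h
    · exact h
    · exact h.symm
    · exact absurd rfl h
  refine ⟨fun s => sInf (S s), fun a b hab => ?_, fun a b c hab hac hbc ⟨h1, h2⟩ => ?_⟩
  · by_contra! hk
    have hzero : ∀ x : Fin m, (x : ℕ).testBit (sInf (S {a, b})) = false := fun x =>
      Nat.testBit_lt_two_pow (x.2.trans_le ((Nat.le_pow_clog one_lt_two m).trans
        (Nat.pow_le_pow_right two_pos hk)))
    exact hmem a b hab (by rw [hzero, hzero])
  · have hA := hmem a b hab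
    have hB := hmem a c hac
    have hC := hmem b c hbc
    simp only at h1 h2
    rw [← h1] at hB
    rw [← h2] at hC
    revert hA hB hC
    cases (a : ℕ).testBit (sInf (S {a, b})) <;> cases (b : ℕ).testBit (sInf (S {a, b})) <;>
      cases (c : ℕ).testBit (sInf (S {a, b})) <;> simp

/-- A coloring of unordered pairs gives a coloring of two-element finsets. -/
theorem exists_finset_coloring {V : Type*} [DecidableEq V] (c : Sym2 V → ℕ) :
    ∃ c' : Finset V → ℕ, ∀ x y, c' {x, y} = c s(x, y) := by
  have hinj : Function.Injective (Sym2.toFinset : Sym2 V → Finset V) := by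
    intro x y h
    ext a
    rw [← Sym2.mem_toFinset, ← Sym2.mem_toFinset, h]
  refine ⟨Function.extend Sym2.toFinset c 0, fun x y => ?_⟩
  rw [← Sym2.toFinset_mk_eq, hinj.extend_apply]

/-- The coloring of the triples of two disjoint copies of `V`: triples inside one copy get a
color from `c`, and the others a color made of the copy containing two of the points, the
color `d` of this pair and the color `e` of the associated grid edge. -/
def sumColoring {V : Type*} [DecidableEq V] (c d : Finset V → ℕ) (e : Finset (V × V) → ℕ)
    (s : Finset (V ⊕ V)) : ℕ ⊕ Bool × ℕ × ℕ :=
  if s.toRight = ∅ then .inl (c s.toLeft)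
  else if s.toLeft = ∅ then .inl (c s.toRight)
  else if s.toLeft.card = 2 then .inr (false, d s.toLeft, e (s.toLeft ×ˢ s.toRight))
  else .inr (true, d s.toRight, e (s.toLeft ×ˢ s.toRight))

section sumColoring

variable {V : Type*} [DecidableEq V] (c d : Finset V → ℕ) (e : Finset (V × V) → ℕ)

theorem sumColoring_left (L : Finset V) :
    sumColoring c d e (L.disjSum ∅) = .inl (c L) := by
  simp [sumColoring, -disjSum_empty]

theorem sumColoring_right {R : Finset V} (hR : R.Nonempty) :
    sumColoring c d e (disjSum ∅ R) = .inl (c R) := by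
  simp [sumColoring, -empty_disjSum, hR.ne_empty]

theorem sumColoring_pair_left {a a' : V} (b : V) (h : a ≠ a') :
    sumColoring c d e (disjSum {a, a'} {b}) = .inr (false, d {a, a'}, e {(a, b), (a', b)}) := by
  have hprod : ({a, a'} : Finset V) ×ˢ ({b} : Finset V) = {(a, b), (a', b)} := by
    rw [insert_eq, union_product, singleton_product_singleton, singleton_product_singleton,
      insert_eq]
  simp only [sumColoring, toLeft_disjSum, toRight_disjSum, hprod, card_pair h]
  simp

theorem sumColoring_pair_right (a : V) {b b' : V} :
    sumColoring c d e (disjSum {a} {b, b'}) = .inr (true, d {b, b'}, e {(a, b), (a, b')}) := by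
  have hprod : ({a} : Finset V) ×ˢ ({b, b'} : Finset V) = {(a, b), (a, b')} := by
    rw [insert_eq, product_union, singleton_product_singleton, singleton_product_singleton,
      insert_eq]
  simp only [sumColoring, toLeft_disjSum, toRight_disjSum, hprod]
  simp

end sumColoring

theorem disjSum_subset_and_card {V W : Type*} {L L' : Finset V} {R R' : Finset W} {k : ℕ}
    (hL : L ⊆ L') (hR : R ⊆ R') (hk : L.card + R.card = k) :
    L.disjSum R ⊆ L'.disjSum R' ∧ (L.disjSum R).card = k :=
  ⟨disjSum_mono hL hR, by rw [card_disjSum, hk]⟩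

theorem sumColoring_mem {m : ℕ} {c d : Finset (Fin m) → ℕ} {e : Finset (Fin m × Fin m) → ℕ}
    {F K G : ℕ} (hc : ∀ s, s.card = 3 → c s < F) (hd : ∀ a b, a ≠ b → d {a, b} < K)
    (he : ∀ x y, gridAdj x y → e {x, y} < G) {L R : Finset (Fin m)} (h : L.card + R.card = 3) :
    sumColoring c d e (L.disjSum R) ∈
      (range F).disjSum ((univ : Finset Bool) ×ˢ range K ×ˢ range G) := by
  have hcases : L.card = 0 ∧ R.card = 3 ∨ L.card = 1 ∧ R.card = 2 ∨ L.card = 2 ∧ R.card = 1 ∨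
      L.card = 3 ∧ R.card = 0 := by omega
  rcases hcases with ⟨hL, hR⟩ | ⟨hL, hR⟩ | ⟨hL, hR⟩ | ⟨hL, hR⟩
  · obtain rfl := card_eq_zero.1 hL
    rw [sumColoring_right _ _ _ (card_pos.1 (by omega))]
    simpa using hc R hR
  · obtain ⟨a, rfl⟩ := card_eq_one.1 hL
    obtain ⟨b, b', hb, rfl⟩ := card_eq_two.1 hR
    rw [sumColoring_pair_right]
    simpa using ⟨hd b b' hb, he (a, b) (a, b') ⟨by simpa using hb, .inl rfl⟩⟩
  · obtain ⟨a, a', ha, rfl⟩ := card_eq_two.1 hL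
    obtain ⟨b, rfl⟩ := card_eq_one.1 hR
    rw [sumColoring_pair_left _ _ _ _ ha]
    simpa using ⟨hd a a' ha, he (a, b) (a', b) ⟨by simpa using ha, .inr rfl⟩⟩
  · obtain rfl := card_eq_zero.1 hR
    rw [sumColoring_left]
    simpa using hc L hL

theorem three_le_card_image_sumColoring {V : Type*} [DecidableEq V]
    {c d : Finset V → ℕ} {e : Finset (V × V) → ℕ}
    (hc : ∀ P : Finset V, P.card = 4 → 3 ≤ ((P.powersetCard 3).image c).card)
    (hd : ∀ x y z, x ≠ y → x ≠ z → y ≠ z → ¬ (d {x, y} = d {x, z} ∧ d {x, y} = d {y, z}))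
    (he : ∀ i i' j j', i ≠ i' → j ≠ j' → ¬ (e {(i, j), (i', j)} = e {(i, j'), (i', j')} ∧
      e {(i, j), (i, j')} = e {(i', j), (i', j')}))
    {L R : Finset V} (h : L.card + R.card = 4) :
    3 ≤ (((L.disjSum R).powersetCard 3).image (sumColoring c d e)).card := by
  have hcases : L.card = 0 ∧ R.card = 4 ∨ L.card = 1 ∧ R.card = 3 ∨ L.card = 2 ∧ R.card = 2 ∨
      L.card = 3 ∧ R.card = 1 ∨ L.card = 4 ∧ R.card = 0 := by omega
  rcases hcases with ⟨hL, hR⟩ | ⟨hL, hR⟩ | ⟨hL, hR⟩ | ⟨hL, hR⟩ | ⟨hL, hR⟩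
  · obtain ⟨_, hx, _, hy, _, hz, hxy, hxz, hyz⟩ := two_lt_card.1 (hc R hR)
    obtain ⟨s, hs, rfl⟩ := mem_image.1 hx
    obtain ⟨t, ht, rfl⟩ := mem_image.1 hy
    obtain ⟨u, hu, rfl⟩ := mem_image.1 hz
    rw [mem_powersetCard] at hs ht hu
    have hs0 : s.Nonempty := card_pos.1 (by omega)
    have ht0 : t.Nonempty := card_pos.1 (by omega)
    have hu0 : u.Nonempty := card_pos.1 (by omega)
    apply three_le_card_image_powersetCard
      (disjSum_subset_and_card (empty_subset L) hs.1 (by simpa using hs.2))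
      (disjSum_subset_and_card (empty_subset L) ht.1 (by simpa using ht.2))
      (disjSum_subset_and_card (empty_subset L) hu.1 (by simpa using hu.2)) <;>
      simpa [-empty_disjSum, sumColoring_right, hs0, ht0, hu0]
  · obtain ⟨a, rfl⟩ := card_eq_one.1 hL
    obtain ⟨x, y, z, hxy, hxz, hyz, rfl⟩ := card_eq_three.1 hR
    have key : ∀ t ⊆ ({x, y, z} : Finset V), t.card = 2 → d {x, y} ≠ d t → (∃ u v, t = {u, v}) →
        3 ≤ (((disjSum {a} {x, y, z}).powersetCard 3).image (sumColoring c d e)).card := by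
      rintro _ ht ht2 hne ⟨u, v, rfl⟩
      apply three_le_card_image_powersetCard
        (disjSum_subset_and_card (empty_subset {a}) Subset.rfl (by simpa using hR))
        (disjSum_subset_and_card (L := {a}) (R := {x, y}) Subset.rfl (by grind)
          (by simp [card_pair hxy]))
        (disjSum_subset_and_card (L := {a}) Subset.rfl ht (by simp [ht2])) <;>
      simp [-empty_disjSum, sumColoring_right, sumColoring_pair_right, hne]
    rcases not_and_or.1 (hd x y z hxy hxz hyz) with hne | hne
    · exact key _ (by grind) (card_pair hxz) hne ⟨_, _, rfl⟩
    · exact key _ (by grind) (card_pair hyz) hne ⟨_, _, rfl⟩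
  · obtain ⟨a, a', ha, rfl⟩ := card_eq_two.1 hL
    obtain ⟨b, b', hb, rfl⟩ := card_eq_two.1 hR
    have hl : ∀ y ∈ ({b, b'} : Finset V),
        disjSum {a, a'} {y} ⊆ disjSum {a, a'} {b, b'} ∧ (disjSum {a, a'} {y}).card = 3 :=
      fun y hy => disjSum_subset_and_card Subset.rfl (by simpa using hy) (by simp [hL])
    have hr : ∀ x ∈ ({a, a'} : Finset V),
        disjSum {x} {b, b'} ⊆ disjSum {a, a'} {b, b'} ∧ (disjSum {x} {b, b'}).card = 3 :=
      fun x hx => disjSum_subset_and_card (by simpa using hx) Subset.rfl (by simp [hR])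
    rcases not_and_or.1 (he a a' b b' ha hb) with hne | hne
    · apply three_le_card_image_powersetCard (hl b (by simp)) (hl b' (by simp))
        (hr a (by simp)) <;>
      simp [sumColoring_pair_left, sumColoring_pair_right, ha, hne]
    · apply three_le_card_image_powersetCard (hr a (by simp)) (hr a' (by simp))
        (hl b (by simp)) <;>
      simp [sumColoring_pair_left, sumColoring_pair_right, ha, hne]
  · obtain ⟨b, rfl⟩ := card_eq_one.1 hR
    obtain ⟨x, y, z, hxy, hxz, hyz, rfl⟩ := card_eq_three.1 hL
    have key : ∀ u v, u ≠ v → {u, v} ⊆ ({x, y, z} : Finset V) → d {x, y} ≠ d {u, v} →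
        3 ≤ (((disjSum {x, y, z} {b}).powersetCard 3).image (sumColoring c d e)).card := by
      intro u v huv ht hne
      apply three_le_card_image_powersetCard
        (disjSum_subset_and_card Subset.rfl (empty_subset {b}) (by simpa using hL))
        (disjSum_subset_and_card (L := {x, y}) (R := {b}) (by grind) Subset.rfl
          (by simp [card_pair hxy]))
        (disjSum_subset_and_card (R := {b}) ht Subset.rfl (by simp [card_pair huv])) <;>
      simp [-disjSum_empty, sumColoring_left, sumColoring_pair_left, hne, hxy, huv]
    rcases not_and_or.1 (hd x y z hxy hxz hyz) with hne | hne
    · exact key x z hxz (by grind) hne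
    · exact key y z hyz (by grind) hne
  · obtain ⟨_, hx, _, hy, _, hz, hxy, hxz, hyz⟩ := two_lt_card.1 (hc L hL)
    obtain ⟨s, hs, rfl⟩ := mem_image.1 hx
    obtain ⟨t, ht, rfl⟩ := mem_image.1 hy
    obtain ⟨u, hu, rfl⟩ := mem_image.1 hz
    rw [mem_powersetCard] at hs ht hu
    apply three_le_card_image_powersetCard
      (disjSum_subset_and_card hs.1 (empty_subset R) (by simpa using hs.2))
      (disjSum_subset_and_card ht.1 (empty_subset R) (by simpa using ht.2))
      (disjSum_subset_and_card hu.1 (empty_subset R) (by simpa using hu.2)) <;>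
      simpa [-disjSum_empty, sumColoring_left]

/-- `HasAltRect` does not depend on the order of the rows and columns. -/
theorem hasAltRect_of_ne {m n : ℕ} {α : Type*} {c : Sym2 (Fin m × Fin n) → α}
    {i i' : Fin m} {j j' : Fin n} (hi : i ≠ i') (hj : j ≠ j')
    (hcol : c s((i, j), (i', j)) = c s((i, j'), (i', j')))
    (hrow : c s((i, j), (i, j')) = c s((i', j), (i', j'))) : HasAltRect c := by
  wlog hi' : i < i' generalizing i i'
  · exact this hi.symm (by rwa [Sym2.eq_swap, @Sym2.eq_swap _ (i', j')]) hrow.symm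
      (lt_of_le_of_ne (not_lt.1 hi') hi.symm)
  wlog hj' : j < j' generalizing j j'
  · exact this hj.symm hcol.symm (by rwa [Sym2.eq_swap, @Sym2.eq_swap _ (i', j')])
      (lt_of_le_of_ne (not_lt.1 hj') hj.symm)
  exact ⟨i, i', j, j', hi', hj', hcol, hrow⟩

/-- Recursive bound (4.1): for every positive integer `m`,
`f_3(2m,4,3) ≤ f_3(m,4,3) + 2⌈log m⌉ g(m)`. -/
theorem f3_recursive (m : ℕ) (hm : 0 < m) :
    f3 (2 * m) 4 3 ≤ f3 m 4 3 + 2 * Nat.clog 2 m * gGrid m m := by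
  obtain ⟨c, hc, hc'⟩ := exists_coloring_f3 m
  obtain ⟨d, hd, hd'⟩ := exists_coloring_pairs m
  obtain ⟨e₀, he, he'⟩ := exists_coloring_gGrid m m
  obtain ⟨e, hee⟩ := exists_finset_coloring e₀
  have hT : ((range (f3 m 4 3)).disjSum
      ((univ : Finset Bool) ×ˢ range (Nat.clog 2 m) ×ˢ range (gGrid m m))).card =
      f3 m 4 3 + 2 * Nat.clog 2 m * gGrid m m := by
    simp [mul_assoc]
  rw [← hT]
  refine f3_le_card (V := Fin m ⊕ Fin m) (by simp [two_mul]) (sumColoring c d e) _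
    (fun s hs => ?_) (fun P hP => ?_)
  · rw [← s.toLeft_disjSum_toRight] at hs ⊢
    exact sumColoring_mem hc hd (fun x y h => hee x y ▸ he x y h) (by rwa [card_disjSum] at hs)
  · rw [← P.toLeft_disjSum_toRight] at hP ⊢
    refine three_le_card_image_sumColoring hc' hd' (fun i i' j j' hi hj ⟨h₁, h₂⟩ => ?_)
      (by rwa [card_disjSum] at hP)
    simp only [hee] at h₁ h₂
    exact he' (hasAltRect_of_ne hi hj h₁ h₂)
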